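/- Let n ≥ 3 and let L_1 and L_2 be lexsegment sets in R_t of sizes b and c respectively, with b ≥ c, and let j_1 = I(L_1), j_2 = I(L_2). Define t' = t − j_2 if j_1 = j_2, j_1 ≠ a−1, and x_1^{j_1} x_n^{t−j_1} ∉ L_1 ∪ L_2; and t' = t + 1 − j_2 otherwise. Then b_{n,t} + c_{n,t} > (b+c)_{n,t+t'}. -/

import Mathlib

open scoped Classical
open Finset

noncomputable section

/-- The monomials of degree `t` in `n` variables, identified with exponent vectors. -/
def degMon (n t : ℕ) : Finset (Fin n → ℕ) := Finset.Nat.antidiagonalTuple n t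

/-- The exponent of `x_1` in a monomial. -/
def x1exp {n : ℕ} (m : Fin n → ℕ) : ℕ := if h : 0 < n then m ⟨0, h⟩ else 0

/-- `lexLt u v` : `u` is lexicographically smaller than `v` as monomials
(with `x_1 > x_2 > ... > x_n`), i.e. `v > u`. -/
def lexLt {n : ℕ} (u v : Fin n → ℕ) : Prop :=
  ∃ i : Fin n, (∀ j : Fin n, j < i → u j = v j) ∧ u i < v i

/-- `M` is a lexsegment set inside the ground set `G` of monomials. -/
def IsLexSeg {n : ℕ} (G M : Finset (Fin n → ℕ)) : Prop :=
  M ⊆ G ∧ ∀ m ∈ M, ∀ v ∈ G, lexLt m v → v ∈ M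

/-- The lexsegment set consisting of the top `d` monomials of `G` in the lex order. -/
def lexSeg {n : ℕ} (G : Finset (Fin n → ℕ)) (d : ℕ) : Finset (Fin n → ℕ) :=
  G.filter (fun m => (G.filter (fun v => m = v ∨ lexLt m v)).card ≤ d)

/-- `S_1 · M` : all monomials `u * m` with `u` a variable and `m ∈ M`. -/
def S1mul (n : ℕ) (M : Finset (Fin n → ℕ)) : Finset (Fin n → ℕ) :=
  Finset.univ.biUnion (fun i : Fin n => M.image (fun m => m + Pi.single i 1))

/-- `S'_1 · M` : all monomials `x_i * m` with `2 ≤ i ≤ n` and `m ∈ M`. -/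
def S1'mul (n : ℕ) (M : Finset (Fin n → ℕ)) : Finset (Fin n → ℕ) :=
  (Finset.univ.filter (fun i : Fin n => (i : ℕ) ≠ 0)).biUnion
    (fun i => M.image (fun m => m + Pi.single i 1))

/-- `d^{<k>}` : the number of monomials obtained by multiplying each member of the
lexsegment set of `d` monomials of a fixed degree in `k+1` variables by each of the
`k+1` variables.  (We realize it in degree `d`, where the lexsegment set exists;
the number is independent of the chosen degree.  Also `0^{<k>} = 0`.) -/
def growth (d k : ℕ) : ℕ := (S1mul (k + 1) (lexSeg (degMon (k + 1) d) d)).card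

/-- The monomials of `R_t` where `R = S/(x_1^a)` : degree-`t` monomials whose
`x_1`-exponent is at most `a - 1`. -/
def RMon (n a t : ℕ) : Finset (Fin n → ℕ) :=
  (degMon n t).filter (fun m => x1exp m < a)

/-- `R_1 · M` : the monomials of `S_1 · M` not divisible by `x_1^a`. -/
def R1mul (n a : ℕ) (M : Finset (Fin n → ℕ)) : Finset (Fin n → ℕ) :=
  (S1mul n M).filter (fun m => x1exp m < a)

/-- `d_{n,t}` : the size of `R_1 · L` for the lexsegment set `L` of `d` monomials in `R_t`. -/
def dnt (n a t d : ℕ) : ℕ := (R1mul n a (lexSeg (RMon n a t) d)).card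

/-- `M^i` : the monomials of `M` divisible by `x_1^i` but not by `x_1^{i+1}`. -/
def comp {n : ℕ} (M : Finset (Fin n → ℕ)) (i : ℕ) : Finset (Fin n → ℕ) :=
  M.filter (fun m => x1exp m = i)

/-- `I(M)` : the smallest `i` such that `M^i ≠ ∅`. -/
def Imon {n : ℕ} (M : Finset (Fin n → ℕ)) : ℕ := sInf {i | (comp M i).Nonempty}

/-- `M` is Gotzmann in `S_t`. -/
def GotzmannS (n t : ℕ) (M : Finset (Fin n → ℕ)) : Prop :=
  (S1mul n (lexSeg (degMon n t) M.card)).card = (S1mul n M).card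

/-- `M` is Gotzmann in `R_t`, `R = S/(x_1^a)`. -/
def GotzmannR (n a t : ℕ) (M : Finset (Fin n → ℕ)) : Prop :=
  (R1mul n a (lexSeg (RMon n a t) M.card)).card = (R1mul n a M).card

/-- The monomials of degree `t` of `S' = F[x_2,...,x_n]`, viewed inside the `n`
variables as the monomials with `x_1`-exponent `0`. -/
def SpMon (n t : ℕ) : Finset (Fin n → ℕ) :=
  (degMon n t).filter (fun m => x1exp m = 0)

/-- `M` is Gotzmann in `S' = F[x_2,...,x_n]` (in degree `t`). -/
def GotzmannSp (n t : ℕ) (M : Finset (Fin n → ℕ)) : Prop :=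
  (S1'mul n (lexSeg (SpMon n t) M.card)).card = (S1'mul n M).card

/-- Dividing a monomial by the pure power of `x_1` it contains: set the first exponent to `0`. -/
def clearX1 {n : ℕ} (m : Fin n → ℕ) : Fin n → ℕ :=
  fun j => if (j : ℕ) = 0 then 0 else m j

/-- `M^i / x_1` : the monomials `m` of `S'` with `m * x_1^i ∈ M^i` (applied to `M = M^i`). -/
def divX1 {n : ℕ} (M : Finset (Fin n → ℕ)) : Finset (Fin n → ℕ) :=
  M.image clearX1

/-- `u · M` : the monomials `u * m` with `m ∈ M`. -/
def mulMon {n : ℕ} (u : Fin n → ℕ) (M : Finset (Fin n → ℕ)) : Finset (Fin n → ℕ) :=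
  M.image (fun m => u + m)

/-- The set `B` of degree-`t` monomials of `S` divisible by `x_1^a`. -/
def Bset (n a t : ℕ) : Finset (Fin n → ℕ) :=
  (degMon n t).filter (fun m => a ≤ x1exp m)
/-- W -/
def Wl : ℕ → ℕ → List ℕ
  | 0, _ => [1]
  | (N+1), s => (N+2) :: (List.range s).flatMap (fun i => Wl N (1+i))
/-- U -/
def Ul (N p k : ℕ) : List ℕ := (List.range k).flatMap (fun i => Wl N (p+i))

theorem Wl_succ (N s : ℕ) : Wl (N+1) s = (N+2) :: Ul N 1 s := by
  simp [Wl, Ul]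
theorem Wl_zero (N : ℕ) : Wl N 0 = [N+1] := by
  cases N <;> simp [Wl]
theorem Ul_add (N p k l : ℕ) : Ul N p (k+l) = Ul N p k ++ Ul N (p+k) l := by
  simp [Ul, List.range_add, List.flatMap_append, List.flatMap_map, add_assoc]
theorem Ul_one (N p : ℕ) : Ul N p 1 = Wl N p := by simp [Ul]
theorem Ul_zero (N p : ℕ) : Ul N p 0 = [] := by simp [Ul]
theorem Ul_succ (N p k : ℕ) : Ul N p (k+1) = Wl N p ++ Ul N (p+1) k := by
  rw [add_comm k, Ul_add, Ul_one]
theorem Ul_succ' (N p k : ℕ) : Ul N p (k+1) = Ul N p k ++ Wl N (p+k) := by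
  rw [Ul_add, Ul_one]
theorem Wl_prefix (N p q : ℕ) (h : p ≤ q) : Wl N p <+: Wl N q := by
  obtain ⟨r, rfl⟩ := Nat.exists_eq_add_of_le h
  cases N with
  | zero => simp [Wl]
  | succ N => 
    rw [Wl_succ, Wl_succ, Ul_add]
    simp
theorem Wl_ne (N p : ℕ) : Wl N p ≠ [] := by cases N <;> simp [Wl]
theorem Wl_len_pos (N p : ℕ) : 0 < (Wl N p).length := List.length_pos_iff.2 (Wl_ne N p)
theorem Wl_len_mono (N p q : ℕ) (h : p ≤ q) : (Wl N p).length ≤ (Wl N q).length :=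
  (Wl_prefix N p q h).length_le
theorem Ul_len_mono (N p q k : ℕ) (h : p ≤ q) : (Ul N p k).length ≤ (Ul N q k).length := by
  induction k with
  | zero => simp [Ul_zero]
  | succ k ih => 
    rw [Ul_succ', Ul_succ', List.length_append, List.length_append]
    have := Wl_len_mono N (p+k) (q+k) (by omega)
    omega
theorem cap1 (N p q : ℕ) : (Wl (N+1) p).length + (Wl (N+1) q).length ≤ (Wl (N+1) (p+q)).length + 1 := by
  have := Ul_len_mono N 1 (1+p) q (by omega)
  simp [Wl_succ, Ul_add]; omega
theorem cap2 (N p q : ℕ) : (Wl (N+1) p).length + (Wl (N+1) q).length ≤ (Wl (N+1) (p+q+1)).length := by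
  have := cap1 N p q
  have := Wl_len_pos N (1+(p+q))
  simp [Wl_succ, Ul_succ'] at *; omega

theorem structA (N : ℕ) (I : List ℕ) (k : ℕ) : ∀ p, I <:+: Ul N p k → 
    (I = [] ∨ (∃ s, p ≤ s ∧ I <:+: Wl N s)) ∨ ∃ s T J k', p ≤ s ∧ I = T ++ J ∧ T ≠ [] ∧ J ≠ [] ∧ T <:+ Wl N s ∧
      J <:+: Ul N (s+1) k' := by
  induction k with
  | zero => intro p h; left; left; simpa [Ul_zero] using h
  | succ k ih =>
    intro p h
    rw [Ul_succ, List.infix_append_iff] at h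
    rcases h with h | h | ⟨T, J, rfl, h1, h2⟩
    · left; right; exact ⟨p, le_rfl, h⟩
    · rcases ih _ h with (h | ⟨s, hs, h⟩) | ⟨s, T, J, k', hs, h⟩
      · left; left; exact h
      · left; right; exact ⟨s, by omega, h⟩
      · right; exact ⟨s, T, J, k', by omega, h⟩
    · by_cases hT : T = []
      · subst hT
        rcases ih (p+1) (by simpa using h2.isInfix) with (h | ⟨s, hs, h⟩) | ⟨s, T, J, k', hs, h⟩
        · left; left; exact h
        · left; right; exact ⟨s, by omega, h⟩
        · right; exact ⟨s, T, J, k', by omega, h⟩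
      · by_cases hJ : J = []
        · subst hJ; left; right; exact ⟨p, le_rfl, by simpa using h1.isInfix⟩
        · right; exact ⟨p, T, J, k, le_rfl, rfl, hT, hJ, h1, h2.isInfix⟩

theorem structB (N : ℕ) (I : List ℕ) (p k : ℕ) : I <:+: Ul N p k → 
    (I = [] ∨ (∃ s, s < p + k ∧ I <:+: Wl N s)) ∨ ∃ s T J k', s < p + k ∧ p + k' ≤ s ∧ I = T ++ J ∧ T ≠ [] ∧ J ≠ [] ∧ J <+: Wl N s ∧
      T <:+: Ul N p k' := by
  induction k with
  | zero => intro h; left; left; simpa [Ul_zero] using h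
  | succ k ih =>
    intro h
    rw [Ul_succ', List.infix_append_iff] at h
    rcases h with h | h | ⟨T, J, rfl, h1, h2⟩
    · rcases ih h with (h | ⟨s, hs, h⟩) | ⟨s, T, J, k', hs, h⟩
      · left; left; exact h
      · left; right; exact ⟨s, by omega, h⟩
      · right; exact ⟨s, T, J, k', by omega, h⟩
    · left; right; exact ⟨p+k, by omega, h⟩
    · by_cases hT : J = []
      · subst hT
        rcases ih (by simpa using h1.isInfix) with (h | ⟨s, hs, h⟩) | ⟨s, T, J, k', hs, h⟩
        · left; left; exact h
        · left; right; exact ⟨s, by omega, h⟩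
        · right; exact ⟨s, T, J, k', by omega, h⟩
      · by_cases hJ : T = []
        · subst hJ; left; right; exact ⟨p+k, by omega, by simpa using h2.isInfix⟩
        · right; exact ⟨p+k, T, J, k, by omega, by omega, rfl, hJ, hT, h2, h1.isInfix⟩

def OneA (N : ℕ) : Prop := ∀ p s I, I <:+: Wl N s → I.length ≤ (Wl N p).length →
  I.sum ≤ ((Wl N p).take I.length).sum
def OneB (N : ℕ) : Prop := ∀ p s T I, p ≤ s → T <:+ Wl N s → I <:+: Wl N p → T.length = I.length →
  T.sum ≤ I.sum
def MulA (N : ℕ) : Prop := ∀ p p' k k' I, p ≤ p' → I <:+: Ul N p' k' → I.length ≤ (Ul N p k).length →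
  I.sum ≤ ((Ul N p k).take I.length).sum
def MulB (N : ℕ) : Prop := ∀ p p' k k' T I, p + k ≤ p' + k' → T <:+ Ul N p' k' → I <:+: Ul N p k → 
  T.length = I.length → T.sum ≤ I.sum

theorem infix_drop {I A C : List ℕ} (h : I <:+: A ++ C) : I.drop A.length <:+: C := by
  obtain ⟨X, Y, h⟩ := h
  have h2 := congrArg (List.drop A.length) h
  simp only [List.drop_append, le_refl, List.drop_eq_nil_of_le, tsub_self, List.drop_zero, List.nil_append] at h2
  rw [← h2]
  have : I.drop A.length <:+ I.drop (A.length - X.length) := by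
    have : A.length = (A.length - X.length) + (A.length - (A.length - X.length)) := by omega
    conv_lhs => rw [this, ← List.drop_drop]
    exact List.drop_suffix _ _
  exact this.isInfix.trans ⟨_, _, rfl⟩

theorem infix_take {I A C : List ℕ} (h : I <:+: A ++ C) : I.take (I.length - C.length) <:+: A := by
  have h2 : I.reverse <:+: C.reverse ++ A.reverse := by
    rw [← List.reverse_append]; exact List.reverse_infix.2 h
  have := infix_drop h2
  rw [List.length_reverse, List.drop_reverse, List.reverse_infix] at this
  exact this

theorem mulA_of (N : ℕ) (hA : OneA N) (hB : OneB N) : MulA N := by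
  intro p p' k k' I
  induction hd : I.length using Nat.strong_induction_on generalizing p p' k k' I with
  | _ d ih =>
  intro hp hI hl
  subst hd
  by_cases h0 : I = []
  · subst h0; simp
  have hIpos := List.length_pos_iff.2 h0
  obtain ⟨k, rfl⟩ : ∃ l, k = l + 1 := by
    cases k with
    | zero => simp [Ul_zero] at hl; exact absurd hl h0
    | succ l => exact ⟨l, rfl⟩
  rw [Ul_succ] at hl ⊢
  have hWpos := Wl_len_pos N p
  by_cases hs : I.length ≤ (Wl N p).length
  · rw [List.take_append_of_le_length hs]
    rcases structA N I k' p' hI with (h | ⟨s, hs', h⟩) | ⟨s, T, J, k'', hs', rfl, hT, hJ, hTW, hJU⟩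
    · exact absurd h h0
    · exact hA p s I h hs
    · have hTpos := List.length_pos_iff.2 hT
      rw [List.length_append] at *
      have h1 := ih J.length (by omega) p (s+1) 1 k'' J rfl (by omega) hJU (by rw [Ul_one]; omega)
      rw [Ul_one] at h1
      have h2 := hB p s T (((Wl N p).drop J.length).take T.length) (by omega) hTW
        ((List.take_prefix _ _).isInfix.trans (List.drop_suffix _ _).isInfix) (by simp; omega)
      rw [add_comm T.length, List.take_add, List.sum_append, List.sum_append]
      omega
  · push Not at hs
    rw [List.take_append, List.sum_append, List.take_of_length_le hs.le]
    have e : I.sum = (I.take (Wl N p).length).sum + (I.drop (Wl N p).length).sum := by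
      rw [← List.sum_append, List.take_append_drop]
    rw [e]
    rw [List.length_append] at hl
    have h1 := ih (Wl N p).length hs p p' 1 k' (I.take (Wl N p).length) (by simp; omega) hp
      ((List.take_prefix _ _).isInfix.trans hI) (by simp [Ul_one])
    rw [Ul_one, List.take_length] at h1
    have hl2 : (I.drop (Wl N p).length).length = I.length - (Wl N p).length := by simp
    have : ∃ p'' k'', p+1 ≤ p'' ∧ I.drop (Wl N p).length <:+: Ul N p'' k'' := by
      rcases hp.lt_or_eq with h | h
      · exact ⟨p', k', h, (List.drop_suffix _ _).isInfix.trans hI⟩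
      · subst h
        cases k' with
        | zero => simp [Ul_zero] at hI; exact absurd hI h0
        | succ k' => 
          rw [Ul_succ] at hI
          exact ⟨p+1, k', le_rfl, infix_drop hI⟩
    obtain ⟨p'', k'', hp'', h3⟩ := this
    have h2 := ih _ (by omega) (p+1) p'' k k'' _ hl2 hp'' h3 (by omega)
    omega

theorem mulB_of (N : ℕ) (hA : OneA N) (hB : OneB N) : MulB N := by
  intro p p' k k' T I
  induction hd : I.length using Nat.strong_induction_on generalizing p p' k k' T I with
  | _ d ih =>
  intro hp hT hI hl
  subst hd
  by_cases h0 : I = []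
  · subst h0; simp at hl; simp [hl]
  have hIpos := List.length_pos_iff.2 h0
  obtain ⟨k', rfl⟩ : ∃ l, k' = l + 1 := by
    cases k' with
    | zero => simp [Ul_zero] at hT; subst hT; simp at hl; omega
    | succ l => exact ⟨l, rfl⟩
  have hWpos := Wl_len_pos N (p'+k')
  have hTU := hT
  rw [Ul_succ'] at hT
  by_cases hs : I.length ≤ (Wl N (p'+k')).length
  · have hTW : T <:+ Wl N (p'+k') := 
      List.suffix_of_suffix_length_le hT (List.suffix_append _ _) (by omega)
    rcases structB N I p k hI with (h | ⟨s, hs', h⟩) | ⟨s, T', J, k'', hs', hk'', rfl, hT', hJ, hTW', hJU⟩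
    · exact absurd h h0
    · exact hB s (p'+k') T I (by omega) hTW h hl
    · have hTpos := List.length_pos_iff.2 hT'
      have hJpos := List.length_pos_iff.2 hJ
      rw [List.length_append] at *
      have e : T.sum = (T.take J.length).sum + (T.drop J.length).sum := by
        rw [← List.sum_append, List.take_append_drop]
      have h1 := ih T'.length (by omega) p p' k'' (k'+1) (T.drop J.length) T' rfl (by omega) 
        ((List.drop_suffix _ _).trans hTU) hJU (by simp; omega)
      have h2 := hA s (p'+k') (T.take J.length) ((List.take_prefix _ _).isInfix.trans hTW.isInfix)
        (by have := hTW'.length_le; simp; omega)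
      have e2 : (T.take J.length).length = J.length := by simp; omega
      rw [e2, ← List.prefix_iff_eq_take.1 hTW'] at h2
      rw [e, List.sum_append]
      omega
  · push Not at hs
    obtain ⟨Z, rfl, hZ⟩ : ∃ Z, T = Z ++ Wl N (p'+k') ∧ Z <:+ Ul N p' k' := by
      obtain ⟨X, hX⟩ := hT
      have h1 : Wl N (p'+k') <:+ T := 
        List.suffix_of_suffix_length_le (List.suffix_append _ _) (⟨X, hX⟩) (by omega)
      obtain ⟨Z, rfl⟩ := h1
      refine ⟨Z, rfl, X, ?_⟩
      rw [← List.append_assoc] at hX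
      exact List.append_cancel_right hX
    rw [List.length_append] at hl
    have e : I.sum = (I.take Z.length).sum + (I.drop Z.length).sum := by
      rw [← List.sum_append, List.take_append_drop]
    rw [e, List.sum_append]
    have h1 := ih (Wl N (p'+k')).length hs p p' k (k'+1) (Wl N (p'+k')) (I.drop Z.length) (by simp; omega) hp
      (by rw [Ul_succ']; exact List.suffix_append _ _) ((List.drop_suffix _ _).isInfix.trans hI) rfl
    have : ∃ k'', p + k'' ≤ p' + k' ∧ I.take Z.length <:+: Ul N p k'' := by
      cases k with
      | zero => simp [Ul_zero] at hI; exact absurd hI h0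
      | succ k => 
        rw [Ul_succ'] at hI
        refine ⟨k, by omega, ?_⟩
        have h5 := infix_take hI
        have h6 := Wl_len_mono N (p+k) (p'+k') (by omega)
        refine List.IsInfix.trans ?_ h5
        apply List.IsPrefix.isInfix
        exact List.take_prefix_take_left (by omega)
    obtain ⟨k'', hk'', h3⟩ := this
    have h2 := ih Z.length (by omega) p p' k'' k' Z (I.take Z.length) (by simp; omega) hk'' hZ h3 rfl
    omega

theorem oneA_succ (N : ℕ) (hA : MulA N) : OneA (N+1) := by
  intro p s I hI hl
  by_cases h0 : I = []
  · subst h0; simp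
  have hIpos := List.length_pos_iff.2 h0
  by_cases hpre : I <+: Wl (N+1) s
  · have : I <+: Wl (N+1) p := by
      rcases le_total p s with h | h
      · exact List.prefix_of_prefix_length_le hpre (Wl_prefix _ _ _ h) hl
      · exact hpre.trans (Wl_prefix _ _ _ h)
    rw [← List.prefix_iff_eq_take.1 this]
  · rw [Wl_succ, List.infix_cons_iff] at hI
    rw [Wl_succ] at hpre
    have hI := hI.resolve_left hpre
    have e : Ul N 0 (p+1) = (N+1) :: Ul N 1 p := by
      rw [Ul_succ, Wl_zero]; simp
    rw [Wl_succ] at hl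
    have := hA 0 1 (p+1) s I (by omega) hI (by rw [e]; simpa using hl)
    rw [e] at this
    rw [Wl_succ]
    obtain ⟨m, hm⟩ : ∃ m, I.length = m+1 := ⟨I.length-1, by omega⟩
    rw [hm] at this ⊢
    simp at this ⊢
    omega

theorem oneB_succ (N : ℕ) (hB : MulB N) : OneB (N+1) := by
  intro p s T I hps hT hI hl
  by_cases h0 : T = Wl (N+1) s
  · have h1 : I = Wl (N+1) p := by
      apply hI.eq_of_length
      have := hI.length_le
      have := Wl_len_mono (N+1) p s hps
      subst h0; omega
    have h2 : Wl (N+1) p = Wl (N+1) s := (Wl_prefix (N+1) p s hps).eq_of_length (by subst h0; rw [← h1]; omega)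
    rw [h0, h1, h2]
  · rw [Wl_succ, List.suffix_cons_iff] at hT
    rw [Wl_succ] at h0
    have hT := hT.resolve_left h0
    rw [Wl_succ, List.infix_cons_iff] at hI
    rcases hI with hI | hI
    · rcases List.prefix_cons_iff.1 hI with rfl | ⟨I', rfl, hI'⟩
      · simp at hl; simp [hl]
      · have := hB 0 1 (p+1) s T ((N+1)::I') (by omega) hT (by
          rw [Ul_succ, Wl_zero]; 
          apply List.IsPrefix.isInfix
          simpa using hI') (by simpa using hl)
        simp at this ⊢
        omega
    · exact hB 1 1 p s T I (by omega) hT hI hl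

theorem one_all (N : ℕ) : OneA N ∧ OneB N := by
  induction N with
  | zero =>
    constructor
    · intro p s I hI hl
      simp only [Wl] at *
      have := List.sublist_singleton.1 hI.sublist
      rcases this with rfl | rfl <;> simp
    · intro p s T I _ hT hI hl
      simp only [Wl] at *
      rcases List.sublist_singleton.1 hI.sublist with rfl | rfl <;> 
      rcases List.sublist_singleton.1 hT.sublist with rfl | rfl <;> simp at *
  | succ N ih => exact ⟨oneA_succ N (mulA_of N ih.1 ih.2), oneB_succ N (mulB_of N ih.1 ih.2)⟩
theorem mulA (N : ℕ) : MulA N := mulA_of N (one_all N).1 (one_all N).2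

/-- strict subadditivity in one block -/
theorem strictG (N s b c p q: ℕ) (hb : 0 < b) (hc : 0 < c) (hbp : b ≤ (Wl (N+1) p).length) 
  (hcq : c ≤ (Wl (N+1) q).length)
  (h : b + c ≤ (Wl (N+1) s).length) :
  ((Wl (N+1) s).take (b+c)).sum < ((Wl (N+1) p).take b).sum + ((Wl (N+1) q).take c).sum := by
  have h1 : (Wl (N+1) s).take b = (Wl (N+1) p).take b := by
    rcases le_total p s with h' | h'
    · obtain ⟨Z, hZ⟩ := Wl_prefix (N+1) _ _ h'
      rw [← hZ, List.take_append_of_le_length hbp]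
    · obtain ⟨Z, hZ⟩ := Wl_prefix (N+1) _ _ h'
      rw [← hZ, List.take_append_of_le_length (by omega)]
  rw [List.take_add, List.sum_append, h1]
  have e : Ul N 0 (q+1) = (N+1) :: Ul N 1 q := by
    rw [Ul_succ, Wl_zero]; simp
  obtain ⟨b, rfl⟩ : ∃ m, b = m+1 := ⟨b-1, by omega⟩
  have h2 := mulA N 0 1 (q+1) s (((Wl (N+1) s).drop (b+1)).take c) (by omega) (by
    rw [Wl_succ, List.drop_succ_cons]
    exact (List.take_prefix _ _).isInfix.trans (List.drop_suffix _ _).isInfix) (by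
      rw [e]; rw [Wl_succ] at hcq; simp at hcq ⊢; omega)
  have e2 : (((Wl (N+1) s).drop (b+1)).take c).length = c := by simp; omega
  rw [e2, e] at h2
  obtain ⟨c, rfl⟩ : ∃ m, c = m+1 := ⟨c-1, by omega⟩
  rw [Wl_succ N q]
  simp at h2 ⊢
  omega

/-- the ordered list of weights -/
def Rl (N a t : ℕ) : List ℕ := if t + 1 < a then Wl (N+1) t else Ul N (t+1-a) a

theorem main_neg (N a t t' b c : ℕ) (ht : t + 1 < a) (hb0 : 0 < b) (hc0 : 0 < c)
  (hb : b ≤ (Rl N a t).length) (hc : c ≤ (Rl N a t).length) 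
  (h : b + c ≤ (Rl N a (t+t')).length) : 
  ((Rl N a (t+t')).take (b+c)).sum < ((Rl N a t).take b).sum + ((Rl N a t).take c).sum := by
  unfold Rl at *
  rw [if_pos ht] at *
  split_ifs at h ⊢ with h1
  · exact strictG N _ b c t t hb0 hc0 hb hc h
  · have key : ∀ d ≥ 1, d ≤ (Wl (N+1) t).length → ∀ x, x + d ≤ (Ul N (t+t'+1-a) a).length → 
      (((Ul N (t+t'+1-a) a).drop x).take d).sum < ((Wl (N+1) t).take d).sum := by
      intro d hd hd2 x hx
      have e : Ul N 0 (t+1) = (N+1) :: Ul N 1 t := by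
        rw [Ul_succ, Wl_zero]; simp
      have := mulA N 0 (t+t'+1-a) (t+1) a (((Ul N (t+t'+1-a) a).drop x).take d) (by omega) 
        ((List.take_prefix _ _).isInfix.trans (List.drop_suffix _ _).isInfix) (by
          rw [e]; rw [Wl_succ] at hd2; simp at hd2 ⊢; omega)
      have e2 : (((Ul N (t+t'+1-a) a).drop x).take d).length = d := by simp; omega
      rw [e2, e] at this
      obtain ⟨d, rfl⟩ : ∃ m, d = m+1 := ⟨d-1, by omega⟩
      rw [Wl_succ]
      simp at this ⊢
      omega
    have k1 := key b hb0 hb 0 (by omega)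
    have k2 := key c hc0 hc b (by omega)
    rw [List.drop_zero] at k1
    rw [List.take_add, List.sum_append]
    omega

theorem main_pos (N p p' a b c e : ℕ) (ha : 1 ≤ a) (hb0 : 0 < b) (hcb : c ≤ b)
  (hb : b ≤ (Ul (N+1) p a).length) (he : e < a)
  (h : b + c ≤ (Ul (N+1) p' a).length) 
  (hc1 : (Ul (N+1) p e).length < c) (hc2 : c ≤ (Ul (N+1) p (e+1)).length)
  (hp' : p' = p + (p + e) + 1 ∨ (p' = p + (p+e) ∧ c < (Ul (N+1) p (e+1)).length)) : 
  ((Ul (N+1) p' a).take (b+c)).sum < ((Ul (N+1) p a).take b).sum + ((Ul (N+1) p a).take c).sum := by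
  have key : ∀ r, p ≤ r → ∀ k d, d ≤ (Ul (N+1) r k).length → ∀ x, x + d ≤ (Ul (N+1) p' a).length → r ≤ p' → 
      (((Ul (N+1) p' a).drop x).take d).sum ≤ ((Ul (N+1) r k).take d).sum := by
    intro r hr k d hd2 x hx hrp
    have e2 : (((Ul (N+1) p' a).drop x).take d).length = d := by simp; omega
    have := mulA (N+1) r p' k a (((Ul (N+1) p' a).drop x).take d) hrp 
        ((List.take_prefix _ _).isInfix.trans (List.drop_suffix _ _).isInfix) (by omega)
    rwa [e2] at this
  obtain ⟨k, rfl⟩ := Nat.exists_eq_add_of_lt hc1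
  obtain ⟨f, rfl⟩ := Nat.exists_eq_add_of_lt he
  rw [Ul_succ', List.length_append] at hc2 hp'
  have Ec : ((Ul (N+1) p (e+f+1)).take ((Ul (N+1) p e).length + k + 1)).sum = (Ul (N+1) p e).sum + 
     ((Wl (N+1) (p+e)).take (k+1)).sum := by
    rw [add_assoc e, Ul_add, add_assoc, List.take_length_add_append, List.sum_append, Ul_succ, List.take_append_of_le_length (by omega)]
  rw [Ec]
  obtain ⟨b0, b', rfl, hb0', hbl, Eb⟩ : ∃ b0 b', b = b0 + b' ∧ 0 < b0 ∧ (b0 ≤ (Wl (N+1) p).length ∧ (b' = 0 ∨ b0 = (Wl (N+1) p).length)) ∧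
     ((Ul (N+1) p (e+f+1)).take b).sum = ((Wl (N+1) p).take b0).sum + ((Ul (N+1) (p+1) (e+f)).take b').sum := by
    rw [Ul_succ]
    rcases le_total b (Wl (N+1) p).length with h | h
    · exact ⟨b, 0, by omega, hb0, ⟨h, .inl rfl⟩, by rw [List.take_append_of_le_length h]; simp⟩
    · refine ⟨_, b - (Wl (N+1) p).length, by omega, Wl_len_pos _ _, ⟨le_rfl, .inr rfl⟩, ?_⟩
      rw [List.take_append, List.take_of_length_le h, List.sum_append, List.take_length]
  rw [Eb]
  have cc1 := cap1 N p (p+e)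
  have cc2 := cap2 N p (p+e)
  have hcap : b0 + (k+1) ≤ (Wl (N+1) p').length := by
    rcases hp' with rfl | ⟨rfl, h⟩ <;> omega
  have s1 := strictG N p' b0 (k+1) p (p+e) hb0' (by omega) hbl.1 (by omega) hcap
  have s2 := key p le_rfl e (Ul (N+1) p e).length le_rfl (b0+(k+1)) (by omega) (by omega)
  rw [List.take_length] at s2
  have s3 : (((Ul (N+1) p' (e+f+1)).drop (b0+(k+1)+(Ul (N+1) p e).length)).take b').sum ≤ ((Ul (N+1) (p+1) (e+f)).take b').sum := by
    rcases hbl.2 with rfl | hh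
    · simp
    · rw [Ul_succ, List.length_append] at hb
      rcases Nat.eq_zero_or_pos (e+f) with h0 | h0
      · rw [h0, Ul_zero] at hb
        simp at hb
        have : b' = 0 := by omega
        subst this; simp
      · rcases Nat.eq_zero_or_pos b' with h0 | h0
        · subst h0; simp
        by_cases hpp : p + 1 ≤ p'
        · exact key (p+1) (by omega) (e+f) b' (by omega) _ (by omega) hpp
        · -- p' = p, so p = 0 and e = 0
          exfalso
          have hp0 : p = 0 := by omega
          have he0 : e = 0 := by omega
          subst hp0 he0
          rw [Wl_zero] at hp'
          simp [Ul_zero] at hp'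
          omega
  have : b0 + b' + ((Ul (N+1) p e).length + k + 1) = b0 + (k+1) + (Ul (N+1) p e).length + b' := by omega
  rw [this, List.take_add, List.take_add, List.sum_append, List.sum_append]
  have : (Ul (N+1) p' (e+f+1)).take (b0 + (k+1)) = (Wl (N+1) p').take (b0+(k+1)) := by
    rw [Ul_succ, List.take_append_of_le_length hcap]
  rw [this]
  omega

/-- monomials in descending lex order -/
def Mn : (N : ℕ) → ℕ → List (Fin (N+1) → ℕ)
  | 0, s => [fun _ => s]
  | (N+1), s => (List.range (s+1)).flatMap
      (fun i => (Mn N i).map (fun m => (Fin.cons (s-i) m : Fin (N+1+1) → ℕ)))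

theorem mem_Mn (N : ℕ) : ∀ s m, m ∈ Mn N s ↔ ∑ i, m i = s := by
  induction N with
  | zero => 
    intro s m
    simp only [Mn, List.mem_singleton]
    constructor
    · rintro rfl; simp
    · intro h; funext i; fin_cases i; simpa using h
  | succ N ih =>
    intro s m
    simp only [Mn, List.mem_flatMap, List.mem_range, List.mem_map, ih]
    constructor
    · rintro ⟨i, hi, m', hm', rfl⟩
      rw [Fin.sum_univ_succ]; simp [hm']; omega
    · intro h
      rw [Fin.sum_univ_succ] at h
      refine ⟨∑ i, m (Fin.succ i), by omega, Fin.tail m, rfl, ?_⟩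
      have : s - ∑ i, m (Fin.succ i) = m 0 := by omega
      rw [this, Fin.cons_self_tail]

theorem lexLt_cons {N : ℕ} (x : ℕ) (u v : Fin N → ℕ) (h : lexLt u v) :
    lexLt (Fin.cons x u : Fin (N+1) → ℕ) (Fin.cons x v : Fin (N+1) → ℕ) := by
  obtain ⟨i, h1, h2⟩ := h
  refine ⟨i.succ, ?_, by simpa using h2⟩
  intro j
  refine Fin.cases ?_ ?_ j
  · simp
  · intro j hj; simpa using h1 j (by simpa using hj)

theorem lexLt_cons' {N : ℕ} (x y : ℕ) (u v : Fin N → ℕ) (h : x < y) :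
    lexLt (Fin.cons x u : Fin (N+1) → ℕ) (Fin.cons y v : Fin (N+1) → ℕ) :=
  ⟨0, by intro j hj; simp at hj, by simpa using h⟩

theorem lexLt_irrefl {N : ℕ} (u : Fin N → ℕ) : ¬ lexLt u u := by
  rintro ⟨i, _, h⟩; omega

theorem lexLt_asymm {N : ℕ} (u v : Fin N → ℕ) (h : lexLt u v) : ¬ lexLt v u := by
  rintro ⟨i, h1, h2⟩
  obtain ⟨k, h3, h4⟩ := h
  rcases lt_trichotomy i k with h | h | h
  · have := h3 i h; omega
  · subst h; omega
  · have := h1 k h; omega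

theorem sorted_blocks {N : ℕ} (k x : ℕ) (hx : k ≤ x + 1) (f : ℕ → List (Fin N → ℕ)) 
    (hf : ∀ i, (f i).Pairwise (fun u v => lexLt v u)) :
    ((List.range k).flatMap (fun i => (f i).map (fun m => (Fin.cons (x-i) m : Fin (N+1) → ℕ)))).Pairwise
      (fun u v => lexLt v u) := by
  rw [List.pairwise_flatMap]
  constructor
  · intro i _
    rw [List.pairwise_map]
    exact (hf i).imp (fun h => lexLt_cons _ _ _ h)
  · rw [List.pairwise_iff_getElem]
    intro i j hi hj hij u hu v hv
    rw [List.length_range] at hi hj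
    simp only [List.getElem_range, List.mem_map] at hu hv
    obtain ⟨u, _, rfl⟩ := hu
    obtain ⟨v, _, rfl⟩ := hv
    exact lexLt_cons' _ _ _ _ (by omega)

theorem sorted_Mn (N : ℕ) : ∀ s, (Mn N s).Pairwise (fun u v => lexLt v u) := by
  induction N with
  | zero => intro s; simp [Mn]
  | succ N ih => 
    intro s
    exact sorted_blocks (s+1) s le_rfl (fun i => Mn N i) ih

/-- blocks -/
def UMn (N x p k : ℕ) : List (Fin (N+1+1) → ℕ) := 
  (List.range k).flatMap (fun i => (Mn N (p+i)).map (fun m => (Fin.cons (x-i) m : Fin (N+1+1) → ℕ)))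

theorem UMn_add (N x p k l : ℕ) : ∃ Z, UMn N x p (k+l) = UMn N x p k ++ Z := by
  simp [UMn, List.range_add, List.flatMap_append]

theorem UMn_succ (N x p k : ℕ) : UMn N x p (k+1) = UMn N x p k ++ 
    (Mn N (p+k)).map (fun m => (Fin.cons (x-k) m : Fin (N+1+1) → ℕ)) := by
  simp [UMn, List.range_add, List.flatMap_append]

/-- list of monomials of R -/
def RMn (N a t : ℕ) : List (Fin (N+2) → ℕ) :=
  if t + 1 < a then Mn (N+1) t else UMn N (a-1) (t+1-a) a

theorem sorted_RMn (N a t : ℕ) : (RMn N a t).Pairwise (fun u v => lexLt v u) := by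
  unfold RMn
  split_ifs
  · exact sorted_Mn _ _
  · exact sorted_blocks a (a-1) (by omega) (fun i => Mn N (t+1-a+i)) (fun i => sorted_Mn _ _)

theorem x1exp_eq {N : ℕ} (m : Fin (N+2) → ℕ) : x1exp m = m 0 := by simp [x1exp]

theorem mem_RMon (N a t : ℕ) (m : Fin (N+2) → ℕ) : m ∈ RMon (N+2) a t ↔ ∑ i, m i = t ∧ m 0 < a := by
  simp [RMon, degMon, Finset.Nat.mem_antidiagonalTuple, x1exp_eq]

theorem mem_RMn (N a t : ℕ) (m : Fin (N+2) → ℕ) : m ∈ RMn N a t ↔ m ∈ RMon (N+2) a t := by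
  rw [mem_RMon]
  unfold RMn
  split_ifs with h
  · rw [mem_Mn]
    constructor
    · intro hs
      refine ⟨hs, ?_⟩
      rw [Fin.sum_univ_succ] at hs; omega
    · exact fun h => h.1
  · simp only [UMn, List.mem_flatMap, List.mem_range, List.mem_map, mem_Mn]
    constructor
    · rintro ⟨i, hi, m', hm', rfl⟩
      rw [Fin.sum_univ_succ]; simp [hm']; omega
    · rintro ⟨h1, h2⟩
      rw [Fin.sum_univ_succ] at h1
      refine ⟨a - 1 - m 0, by omega, Fin.tail m, ?_, ?_⟩
      · have : ∑ i, Fin.tail m i = ∑ i, m (Fin.succ i) := rfl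
        omega
      · have : a - 1 - (a - 1 - m 0) = m 0 := by omega
        rw [this, Fin.cons_self_tail]

theorem nodup_of_sorted {N : ℕ} {l : List (Fin N → ℕ)} (h : l.Pairwise (fun u v => lexLt v u)) : l.Nodup := by
  refine h.imp ?_
  intro u v h e
  subst e
  exact lexLt_irrefl _ h

theorem lexSeg_eq {N : ℕ} {l : List (Fin N → ℕ)} (h : l.Pairwise (fun u v => lexLt v u))
    (G : Finset (Fin N → ℕ)) (hG : ∀ m, m ∈ l ↔ m ∈ G) (d : ℕ) : lexSeg G d = (l.take d).toFinset := by
  have hnd := nodup_of_sorted h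
  have hp := List.pairwise_iff_getElem.1 h
  have key : ∀ i (hi : i < l.length), G.filter (fun v => l[i] = v ∨ lexLt l[i] v) = (l.take (i+1)).toFinset := by
    intro i hi
    ext v
    simp only [Finset.mem_filter, List.mem_toFinset, List.mem_take_iff_getElem, ← hG]
    constructor
    · rintro ⟨hv, h2⟩
      obtain ⟨j, hj, rfl⟩ := List.mem_iff_getElem.1 hv
      refine ⟨j, ?_, rfl⟩
      by_contra hcon
      have hij : i < j := by omega
      have h3 := hp i j hi hj hij
      rcases h2 with h2 | h2
      · rw [h2] at h3; exact lexLt_irrefl _ h3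
      · exact lexLt_asymm _ _ h2 h3
    · rintro ⟨j, hj, rfl⟩
      refine ⟨List.getElem_mem _, ?_⟩
      rcases Nat.lt_or_ge j i with h2 | h2
      · right; exact hp j i (by omega) hi h2
      · left; congr 1; omega
  ext m
  simp only [lexSeg, Finset.mem_filter, List.mem_toFinset]
  constructor
  · rintro ⟨h1, h2⟩
    obtain ⟨i, hi, rfl⟩ := List.mem_iff_getElem.1 ((hG m).2 h1)
    rw [key i hi, List.toFinset_card_of_nodup (hnd.sublist (List.take_sublist _ _))] at h2
    rw [List.mem_take_iff_getElem]
    exact ⟨i, by simp at h2; omega, rfl⟩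
  · intro h1
    obtain ⟨i, hi, rfl⟩ := List.mem_take_iff_getElem.1 h1
    have hi' : i < l.length := by omega
    refine ⟨(hG _).1 (List.getElem_mem _), ?_⟩
    rw [key i hi', List.toFinset_card_of_nodup (hnd.sublist (List.take_sublist _ _))]
    simp; omega

/-- new variables -/
def nv {N : ℕ} (a : ℕ) (m : Fin (N+2) → ℕ) : Finset (Fin (N+2)) :=
  Finset.univ.filter (fun i => (∀ j > i, m j = 0) ∧ (m + Pi.single i 1 : Fin (N+2) → ℕ) 0 < a)

theorem card_R1mul (N a t : ℕ) (L : Finset (Fin (N+2) → ℕ)) (hL : IsLexSeg (RMon (N+2) a t) L) :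
    (R1mul (N+2) a L).card = ∑ m ∈ L, (nv a m).card := by
  rw [← Finset.card_sigma]
  symm
  apply Finset.card_bij (fun (x : (_ : Fin (N+2) → ℕ) × Fin (N+2)) _ => x.1 + Pi.single x.2 1)
  · rintro ⟨m, i⟩ h
    simp only [Finset.mem_sigma, nv, Finset.mem_filter, Finset.mem_univ, true_and] at h
    simp only [R1mul, S1mul, Finset.mem_filter, Finset.mem_biUnion, Finset.mem_univ, true_and, Finset.mem_image, x1exp_eq]
    exact ⟨⟨i, m, h.1, rfl⟩, h.2.2⟩
  · rintro ⟨m, i⟩ h ⟨m', i'⟩ h' e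
    simp only [Finset.mem_sigma, nv, Finset.mem_filter, Finset.mem_univ, true_and] at h h' e
    have : i = i' := by
      rcases lt_trichotomy i i' with h1 | h1 | h1
      · have e1 := congrFun e i'
        have := h.2.1 i' h1
        simp [this, Pi.single_apply, h1.ne'] at e1
      · exact h1
      · have e1 := congrFun e i
        have := h'.2.1 i h1
        simp [this, Pi.single_apply, h1.ne'] at e1
    subst this
    have := add_right_cancel e
    subst this
    rfl
  · intro v hv
    simp only [R1mul, S1mul, Finset.mem_filter, Finset.mem_biUnion, Finset.mem_univ, true_and, Finset.mem_image, x1exp_eq] at hv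
    obtain ⟨⟨i, m, hm, rfl⟩, hva⟩ := hv
    set v := (m + Pi.single i 1 : Fin (N+2) → ℕ) with hv
    have hmR := (mem_RMon _ _ _ _).1 (hL.1 hm)
    have hvi : v i ≠ 0 := by simp [hv]
    have hne : (Finset.univ.filter (fun k => v k ≠ 0)).Nonempty := ⟨i, by simp [hvi]⟩
    obtain ⟨k, hk1, hk2⟩ : ∃ k, v k ≠ 0 ∧ ∀ j > k, v j = 0 := by
      refine ⟨_, (Finset.mem_filter.1 (Finset.max'_mem _ hne)).2, ?_⟩
      intro j hj
      by_contra hcon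
      exact absurd (Finset.le_max' (Finset.univ.filter (fun k => v k ≠ 0)) j (by simp [hcon])) (not_le.2 hj)
    have hik : i ≤ k := by
      by_contra hcon
      exact hvi (hk2 i (not_le.1 hcon))
    have hmv : (v - Pi.single k 1) + Pi.single k 1 = v := by
      funext x
      by_cases hx : x = k
      · subst hx; simp; omega
      · simp [hx]
    refine ⟨⟨v - Pi.single k 1, k⟩, ?_, hmv⟩
    simp only [Finset.mem_sigma, nv, Finset.mem_filter, Finset.mem_univ, true_and, hmv]
    refine ⟨?_, ?_, hva⟩
    · rcases hik.eq_or_lt with h | h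
      · subst h
        have : v - Pi.single i 1 = m := by simp [hv]
        rwa [this]
      · apply hL.2 m hm
        · rw [mem_RMon]
          constructor
          · have e1 := congrArg (fun f : Fin (N+2) → ℕ => ∑ x, f x) hmv
            simp only [Pi.add_apply, Finset.sum_add_distrib, hv, hmR.1, Finset.sum_pi_single'] at e1
            simp at e1
            simpa [hv] using e1
          · have : (v - Pi.single k 1 : Fin (N+2) → ℕ) 0 ≤ v 0 := by simp
            omega
        · refine ⟨i, ?_, ?_⟩
          · intro j hj
            have h1 : j ≠ i := hj.ne
            have h2 : j ≠ k := (hj.trans h).ne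
            simp [hv, h1, h2]
          · have h2 : i ≠ k := h.ne
            simp [hv, h2]
    · intro j hj
      simp [hk2 j hj]

theorem isLexSeg_lexSeg {N : ℕ} (G : Finset (Fin N → ℕ)) {l : List (Fin N → ℕ)} (h : l.Pairwise (fun u v => lexLt v u))
    (hG : ∀ m, m ∈ l ↔ m ∈ G) (d : ℕ) : IsLexSeg G (lexSeg G d) := by
  refine ⟨Finset.filter_subset _ _, ?_⟩
  have hp := List.pairwise_iff_getElem.1 h
  rw [lexSeg_eq h G hG]
  intro m hm v hv hlt
  rw [List.mem_toFinset, List.mem_take_iff_getElem] at *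
  obtain ⟨i, hi, rfl⟩ := hm
  obtain ⟨j, hj, rfl⟩ := List.mem_iff_getElem.1 ((hG v).2 hv)
  refine ⟨j, ?_, rfl⟩
  by_contra hcon
  exact lexLt_asymm _ _ hlt (hp i j (by omega) hj (by omega))

/-- weight -/
def wt {N : ℕ} (m : Fin (N+1) → ℕ) : ℕ := (Finset.univ.filter (fun i => ∀ j > i, m j = 0)).card

theorem wt_zero (N : ℕ) : wt (0 : Fin (N+1) → ℕ) = N+1 := by simp [wt]

theorem wt_cons {N : ℕ} (x : ℕ) (m : Fin (N+1) → ℕ) (hm : m ≠ 0) : 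
    wt (Fin.cons x m : Fin (N+1+1) → ℕ) = wt m := by
  unfold wt
  rw [← Finset.card_map (Fin.succEmb (N+1))]
  congr 1
  ext i
  simp only [Finset.mem_filter, Finset.mem_univ, true_and, Finset.mem_map, Fin.coe_succEmb]
  constructor
  · intro h
    revert h
    refine Fin.cases ?_ ?_ i
    · intro h
      exfalso; apply hm
      funext j
      simpa using h j.succ (Fin.succ_pos j)
    · intro i h
      refine ⟨i, ?_, rfl⟩
      intro j hj
      simpa using h j.succ (by simpa using hj)
  · rintro ⟨i, h, rfl⟩ j
    refine Fin.cases ?_ ?_ j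
    · intro hj; simp at hj
    · intro j hj; simpa using h j (by simpa using hj)

theorem Mn_zero (N : ℕ) : Mn N 0 = [0] := by
  induction N with
  | zero => simp [Mn]; rfl
  | succ N ih => 
    simp [Mn, ih]
    funext i
    refine Fin.cases ?_ ?_ i <;> simp

theorem ne_zero_of_mem_Mn {N s : ℕ} (hs : 0 < s) {m : Fin (N+1) → ℕ} (hm : m ∈ Mn N s) : m ≠ 0 := by
  rintro rfl
  rw [mem_Mn] at hm
  simp at hm; omega

theorem map_flatMap_aux {α β : Type} (k : ℕ) (f : ℕ → List α) (w : α → β) (F : ℕ → List β) 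
    (h : ∀ i < k, (f i).map w = F i) : ((List.range k).flatMap f).map w = (List.range k).flatMap F := by
  rw [List.map_flatMap]
  apply List.flatMap_congr
  intro i hi
  exact h i (List.mem_range.1 hi)

theorem wt_Mn (N : ℕ) : ∀ s, (Mn N s).map wt = Wl N s := by
  induction N with
  | zero => intro s; simp [Mn, Wl, wt]
  | succ N ih =>
    intro s
    rw [Wl_succ]
    simp only [Mn]
    rw [List.range_succ_eq_map, List.flatMap_cons, List.map_append, List.flatMap_map, Mn_zero]
    have e0 : (Fin.cons (s-0) (0 : Fin (N+1) → ℕ) : Fin (N+1+1) → ℕ) = Fin.cons s 0 := rfl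
    have : wt (Fin.cons (s-0) (0 : Fin (N+1) → ℕ) : Fin (N+1+1) → ℕ) = N + 2 := by
      unfold wt
      rw [Finset.filter_true_of_mem]
      · simp
      · intro i _ j hj
        revert hj
        refine Fin.cases ?_ ?_ j
        · intro h; simp at h
        · intro j _; simp
    rw [List.map_singleton, List.map_singleton, this, List.singleton_append]
    congr 1
    unfold Ul
    rw [List.map_flatMap]
    apply List.flatMap_congr
    intro i _
    rw [← ih, List.map_map, add_comm 1 i]
    apply List.map_congr_left
    intro m hm
    exact wt_cons _ _ (ne_zero_of_mem_Mn (Nat.succ_pos i) hm)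

theorem nv_big {N a t : ℕ} (h : t + 1 < a) {m : Fin (N+2) → ℕ} (hm : m ∈ Mn (N+1) t) : (nv a m).card = wt m := by
  unfold nv wt
  congr 1
  ext i
  simp only [Finset.mem_filter, Finset.mem_univ, true_and, and_iff_left_iff_imp]
  intro _
  rw [mem_Mn, Fin.sum_univ_succ] at hm
  have : (Pi.single i 1 : Fin (N+2) → ℕ) 0 ≤ 1 := by
    rw [Pi.single_apply]; split_ifs <;> simp
  simp only [Pi.add_apply]
  omega

theorem nv_cons {N a x : ℕ} (hx : x < a) (m : Fin (N+1) → ℕ) (h : m ≠ 0 ∨ x + 1 = a) : 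
    (nv a (Fin.cons x m : Fin (N+1+1) → ℕ)).card = wt m := by
  unfold wt
  rw [← Finset.card_map (Fin.succEmb (N+1))]
  congr 1
  ext i
  simp only [nv, Finset.mem_filter, Finset.mem_univ, true_and, Finset.mem_map, Fin.coe_succEmb]
  constructor
  · intro h'
    revert h'
    refine Fin.cases ?_ ?_ i
    · intro h'
      exfalso
      rcases h with h | h
      · apply h
        funext j
        simpa using h'.1 j.succ (Fin.succ_pos j)
      · have := h'.2
        simp at this
        omega
    · intro i h
      refine ⟨i, ?_, rfl⟩
      intro j hj
      simpa using h.1 j.succ (by simpa using hj)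
  · rintro ⟨i, h, rfl⟩
    refine ⟨?_, ?_⟩
    · intro j
      refine Fin.cases ?_ ?_ j
      · intro hj; simp at hj
      · intro j hj; simpa using h j (by simpa using hj)
    · simpa [Pi.single_apply, (Fin.succ_ne_zero i).symm] using hx

theorem map_UMn (N a p k : ℕ) (hk : k ≤ a) : (UMn N (a-1) p k).map (fun m => (nv a m).card) = Ul N p k := by
  unfold UMn Ul
  rw [List.map_flatMap]
  apply List.flatMap_congr
  intro i hi
  have hi := List.mem_range.1 hi
  rw [← wt_Mn, List.map_map]
  apply List.map_congr_left
  intro m hm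
  apply nv_cons (by omega)
  rcases Nat.eq_zero_or_pos (p+i) with h | h
  · right; omega
  · left; exact ne_zero_of_mem_Mn h hm

theorem map_RMn (N a t : ℕ) : (RMn N a t).map (fun m => (nv a m).card) = Rl N a t := by
  unfold RMn Rl
  split_ifs with h
  · rw [← wt_Mn]
    apply List.map_congr_left
    intro m hm
    exact nv_big h hm
  · exact map_UMn _ _ _ _ le_rfl

theorem dnt_eq (N a t d : ℕ) : dnt (N+2) a t d = ((Rl N a t).take d).sum := by
  unfold dnt
  rw [card_R1mul N a t _ (isLexSeg_lexSeg _ (sorted_RMn N a t) (mem_RMn N a t) d),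
    lexSeg_eq (sorted_RMn N a t) _ (mem_RMn N a t),
    List.sum_toFinset _ ((nodup_of_sorted (sorted_RMn N a t)).sublist (List.take_sublist _ _)),
    List.map_take, map_RMn]

theorem card_RMon (N a t : ℕ) : (RMon (N+2) a t).card = (Rl N a t).length := by
  rw [← map_RMn, List.length_map, ← List.toFinset_card_of_nodup (nodup_of_sorted (sorted_RMn N a t))]
  congr 1
  ext m
  rw [List.mem_toFinset, mem_RMn]

theorem UMn_len (N a p k : ℕ) (hk : k ≤ a) : (UMn N (a-1) p k).length = (Ul N p k).length := by
  rw [← map_UMn N a p k hk, List.length_map]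

theorem mem_UMn_le (N a p k : ℕ) (hk : k ≤ a) (m) (hm : m ∈ UMn N (a-1) p k) : a ≤ m 0 + k := by
  simp only [UMn, List.mem_flatMap, List.mem_range, List.mem_map] at hm
  obtain ⟨i, hi, m', _, rfl⟩ := hm
  simp; omega

theorem find_block (N p : ℕ) (d : ℕ) (hd : 0 < d) : ∀ a, d ≤ (Ul N p a).length → 
    ∃ e < a, (Ul N p e).length < d ∧ d ≤ (Ul N p (e+1)).length := by
  intro a
  induction a with
  | zero => intro h; simp [Ul_zero] at h; omega
  | succ a ih =>
    intro h
    by_cases h2 : d ≤ (Ul N p a).length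
    · obtain ⟨e, he, h3⟩ := ih h2
      exact ⟨e, by omega, h3⟩
    · exact ⟨a, by omega, by omega, h⟩

theorem Imon_eq (N a t d e : ℕ) (ht : ¬ t + 1 < a) (he : e < a) (h1 : (Ul N (t+1-a) e).length < d)
    (h2 : d ≤ (Ul N (t+1-a) (e+1)).length) : Imon (lexSeg (RMon (N+2) a t) d) = a - 1 - e := by
  rw [lexSeg_eq (sorted_RMn N a t) _ (mem_RMn N a t)]
  unfold RMn
  rw [if_neg ht]
  obtain ⟨f, hf⟩ := Nat.exists_eq_add_of_lt he
  have hf : a = e + 1 + f := by omega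
  obtain ⟨Z, hZ⟩ := UMn_add N (a-1) (t+1-a) (e+1) f
  rw [← hf] at hZ
  have htake : (UMn N (a-1) (t+1-a) a).take d = (UMn N (a-1) (t+1-a) (e+1)).take d := by
    rw [hZ, List.take_append_of_le_length]
    rwa [UMn_len _ _ _ _ (by omega)]
  rw [htake]
  unfold Imon
  have hx : ∃ x ∈ (UMn N (a-1) (t+1-a) (e+1)).take d, x 0 = a-1-e := by
    refine ⟨(UMn N (a-1) (t+1-a) (e+1))[(Ul N (t+1-a) e).length]'(by rw [UMn_len _ _ _ _ (by omega)]; omega), ?_, ?_⟩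
    · rw [List.mem_take_iff_getElem]
      refine ⟨_, ?_, rfl⟩
      rw [UMn_len _ _ _ _ (by omega)]; omega
    · have hlen := UMn_len N a (t+1-a) e (by omega)
      have : ∀ (h), ((UMn N (a-1) (t+1-a) (e+1))[(Ul N (t+1-a) e).length]'h) ∈ (Mn N (t+1-a+e)).map (fun m => (Fin.cons (a-1-e) m : Fin (N+1+1) → ℕ)) := by
        rw [UMn_succ]
        intro h
        rw [List.getElem_append_right (by omega)]
        exact List.getElem_mem _
      obtain ⟨m, _, hm⟩ := List.mem_map.1 (this (by rw [UMn_len _ _ _ _ (by omega)]; omega))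
      rw [← hm]; simp
  apply le_antisymm
  · apply Nat.sInf_le
    obtain ⟨x, hx1, hx2⟩ := hx
    refine ⟨x, ?_⟩
    simp only [comp, Finset.mem_filter, List.mem_toFinset, x1exp_eq]
    exact ⟨hx1, hx2⟩
  · apply le_csInf
    · obtain ⟨x, hx1, hx2⟩ := hx
      refine ⟨a-1-e, x, ?_⟩
      simp only [comp, Finset.mem_filter, List.mem_toFinset, x1exp_eq]
      exact ⟨hx1, hx2⟩
    · rintro i ⟨x, hx⟩
      simp only [comp, Finset.mem_filter, List.mem_toFinset, x1exp_eq] at hx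
      have := mem_UMn_le N a (t+1-a) (e+1) (by omega) x (List.mem_of_mem_take hx.1)
      omega

theorem last_mem (N a t e : ℕ) (ht : ¬ t + 1 < a) (he : e < a) (m : Fin (N+2) → ℕ) (hm0 : m 0 = a-1-e)
    (hs : ∑ i, m i = t) : m ∈ lexSeg (RMon (N+2) a t) (Ul N (t+1-a) (e+1)).length := by
  rw [lexSeg_eq (sorted_RMn N a t) _ (mem_RMn N a t)]
  unfold RMn
  rw [if_neg ht]
  obtain ⟨f, hf⟩ := Nat.exists_eq_add_of_lt he
  have hf : a = e + 1 + f := by omega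
  obtain ⟨Z, hZ⟩ := UMn_add N (a-1) (t+1-a) (e+1) f
  rw [← hf] at hZ
  rw [hZ, ← UMn_len N a (t+1-a) (e+1) (by omega), List.take_append_of_le_length le_rfl, List.take_length,
    List.mem_toFinset, UMn_succ, List.mem_append]
  right
  rw [List.mem_map]
  refine ⟨Fin.tail m, ?_, ?_⟩
  · rw [mem_Mn]
    rw [Fin.sum_univ_succ] at hs
    have : ∑ i, Fin.tail m i = ∑ i, m (Fin.succ i) := rfl
    omega
  · rw [← hm0, Fin.cons_self_tail]

/-- Let `n ≥ 3`, let `L_1, L_2` be the lexsegment sets in `R_t` of sizes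
`b ≥ c`, `j_1 = I(L_1)`, `j_2 = I(L_2)`, and let `t' = t - j_2` if `j_1 = j_2`,
`j_1 ≠ a - 1` and `x_1^{j_1} x_n^{t - j_1} ∉ L_1 ∪ L_2`, and `t' = t + 1 - j_2`
otherwise.  Then `b_{n,t} + c_{n,t} > (b + c)_{n,t+t'}`. -/
theorem stmt_15 (n a t b c : ℕ) (hn : 3 ≤ n) (ha : 1 ≤ a)
    (hc0 : 0 < c) (hcb : c ≤ b) (hb : b < (RMon n a t).card)
    (L1 L2 : Finset (Fin n → ℕ))
    (hL1 : L1 = lexSeg (RMon n a t) b) (hL2 : L2 = lexSeg (RMon n a t) c)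
    (j1 j2 : ℕ) (hj1 : j1 = Imon L1) (hj2 : j2 = Imon L2)
    (t' : ℕ)
    (ht' : t' = if j1 = j2 ∧ j1 ≠ a - 1 ∧
          (fun k : Fin n => if (k : ℕ) = 0 then j1
            else if (k : ℕ) = n - 1 then t - j1 else 0) ∉ L1 ∪ L2
        then t - j2 else t + 1 - j2)
    (hsum : b + c < (RMon n a (t + t')).card) :
    dnt n a (t + t') (b + c) < dnt n a t b + dnt n a t c := by
  obtain ⟨N, rfl⟩ : ∃ N, n = (N+1)+2 := ⟨n-3, by omega⟩
  rw [card_RMon] at hb hsum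
  rw [dnt_eq, dnt_eq, dnt_eq]
  by_cases hta : t + 1 < a
  · exact main_neg (N+1) a t t' b c hta (by omega) hc0 (by omega) (by omega) (by omega)
  have R0 : Rl (N+1) a t = Ul (N+1) (t+1-a) a := by simp [Rl, hta]
  have R1 : Rl (N+1) a (t+t') = Ul (N+1) (t+t'+1-a) a := by
    rw [Rl, if_neg (by omega)]
  rw [R0] at hb ⊢
  rw [R1] at hsum ⊢
  obtain ⟨e, he, he1, he2⟩ := find_block (N+1) (t+1-a) c hc0 a (by omega)
  have hj2' : j2 = a - 1 - e := by
    rw [hj2, hL2]; exact Imon_eq (N+1) a t c e hta he he1 he2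
  refine main_pos N (t+1-a) (t+t'+1-a) a b c e ha (by omega) hcb (by omega) he (by omega) he1 he2 ?_
  split_ifs at ht' with hc
  · right
    refine ⟨by omega, ?_⟩
    obtain ⟨h12, -, hnot⟩ := hc
    rcases he2.lt_or_eq with h | h
    · exact h
    · exfalso
      apply hnot
      rw [Finset.mem_union]
      right
      rw [hL2, h]
      apply last_mem (N+1) a t e hta he
      · simp; omega
      · rw [Fin.sum_univ_succ, Fin.sum_univ_castSucc]
        have : ∀ x : Fin (N+1), (x : ℕ) ≠ N + 1 := fun x => by omega
        simp [this]
        omega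
  · left; omega
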